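/- Random joint source-channel code achievability: fix k, n, M ∈ ℕ, a codeword distribution P_X ∈ 𝒫(𝒳^n), a source codebook distribution P_Ŝ ∈ 𝒫(𝒮^k), and a capacity-achieving state distribution q*_Θ ∈ Π_Θ with q*(θ) = ∏_{i=1}^n q*_Θ(θ_i). Then there exists a random joint source-channel code ψ (a probability distribution over pairs of deterministic maps f : 𝒮^k → 𝒳^n, φ : 𝒴^n → 𝒮^k) such that e_𝐝(ψ) ≤ min_{P_{L|S}} max_{θ ∈ 𝒯^n} ( 𝔼[ exp( −| i_{X;Y_{q*}}(X;Y) − log L |⁺ ) | θ ] + 𝔼[ (1 − P_Ŝ(B_𝐝(S)))^L ] ), where the minimum is over conditional distributions P_{L|S} of an integer-valued random variable L with 1 ≤ L ≤ M given S, the conditional law given θ of (S,L,X,Y) is P_S(s) P_{L|S}(l|s) P_X(x) P_{Y|X,Θ}(y|x,θ), i_{X;Y_{q*}}(x;y) = log[ (q* P_{Y|X,Θ})(y|x) / Σ_{x'} P_X(x') (q* P_{Y|X,Θ})(y|x') ] with (q* P_{Y|X,Θ})(y|x) = Σ_θ q*(θ) P_{Y|X,Θ}(y|x,θ), B_𝐝(s)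 = { ŝ ∈ 𝒮^k : d(s,ŝ) ≤ 𝐝 }, and |a|⁺ = max(a,0). -/

import Mathlib

open scoped BigOperators
open Classical MeasureTheory Filter

noncomputable section

namespace AVCGame

/-- A probability mass function on a finite type, as a real-valued function. -/
def IsDist {α : Type*} [Fintype α] (p : α → ℝ) : Prop :=
  (∀ a, 0 ≤ p a) ∧ ∑ a, p a = 1

/-- The set of probability distributions on a finite type. -/
abbrev ProbDist (α : Type*) [Fintype α] := {p : α → ℝ // IsDist p}

/-- Conditional probability distributions (channels/kernels). -/
abbrev Kernel (α β : Type*) [Fintype β] := {Q : α → β → ℝ // ∀ a, IsDist (Q a)}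

/-- Real-valued indicator of a proposition. -/
def ind (P : Prop) : ℝ := if P then 1 else 0

variable {𝒮 𝒳 𝒴 𝒯 α β : Type*}

/-- Memoryless `n`-letter extension of a state-dependent channel. -/
def nCh (W : 𝒯 → 𝒳 → 𝒴 → ℝ) (n : ℕ) (θ : Fin n → 𝒯) (x : Fin n → 𝒳) (y : Fin n → 𝒴) : ℝ :=
  ∏ i, W (θ i) (x i) (y i)

/-- i.i.d. product distribution on `k`-letter strings. -/
def prodF (p : α → ℝ) (k : ℕ) (s : Fin k → α) : ℝ := ∏ i, p (s i)

/-- Block (per-letter averaged) distortion. -/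
def dBlock (dS : 𝒮 → 𝒮 → ℝ) (k : ℕ) (s s' : Fin k → 𝒮) : ℝ := (∑ i, dS (s i) (s' i)) / k

section Values

variable [Fintype 𝒮] [Fintype 𝒳] [Fintype 𝒴] [Fintype 𝒯]

/-- Probability of exceeding distortion `D` under a stochastic code and jammer distribution. -/
def errP (W : 𝒯 → 𝒳 → 𝒴 → ℝ) (PS : 𝒮 → ℝ) (dS : 𝒮 → 𝒮 → ℝ) (D : ℝ) (k n : ℕ)
    (QXS : (Fin k → 𝒮) → (Fin n → 𝒳) → ℝ)
    (QSY : (Fin n → 𝒴) → (Fin k → 𝒮) → ℝ)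
    (q : (Fin n → 𝒯) → ℝ) : ℝ :=
  ∑ θ : Fin n → 𝒯, ∑ s : Fin k → 𝒮, ∑ x : Fin n → 𝒳, ∑ y : Fin n → 𝒴, ∑ s' : Fin k → 𝒮,
    ind (dBlock dS k s s' > D) * q θ * prodF PS k s * QXS s x * nCh W n θ x y * QSY y s'

/-- Upper (minimax) value of the zero-sum game. -/
def upperVal (W : 𝒯 → 𝒳 → 𝒴 → ℝ) (PS : 𝒮 → ℝ) (dS : 𝒮 → 𝒮 → ℝ) (D : ℝ) (k n : ℕ) : ℝ :=
  ⨅ QXS : Kernel (Fin k → 𝒮) (Fin n → 𝒳), ⨅ QSY : Kernel (Fin n → 𝒴) (Fin k → 𝒮),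
    ⨆ q : ProbDist (Fin n → 𝒯), errP W PS dS D k n QXS.1 QSY.1 q.1

/-- Lower (maximin) value of the zero-sum game. -/
def lowerVal (W : 𝒯 → 𝒳 → 𝒴 → ℝ) (PS : 𝒮 → ℝ) (dS : 𝒮 → 𝒮 → ℝ) (D : ℝ) (k n : ℕ) : ℝ :=
  ⨆ q : ProbDist (Fin n → 𝒯), ⨅ QXS : Kernel (Fin k → 𝒮) (Fin n → 𝒳),
    ⨅ QSY : Kernel (Fin n → 𝒴) (Fin k → 𝒮), errP W PS dS D k n QXS.1 QSY.1 q.1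

end Values

/-- Mutual information (base 2) between the input of a channel `Wc` with input law `P`
and the corresponding output. -/
def mutInfo [Fintype α] [Fintype β] (P : α → ℝ) (Wc : α → β → ℝ) : ℝ :=
  ∑ x, ∑ y, P x * Wc x y * Real.logb 2 (Wc x y / ∑ x', P x' * Wc x' y)

/-- The single-letter channel averaged over a state distribution. -/
def avgCh [Fintype 𝒯] (W : 𝒯 → 𝒳 → 𝒴 → ℝ) (qθ : 𝒯 → ℝ) (x : 𝒳) (y : 𝒴) : ℝ :=
  ∑ θ, qθ θ * W θ x y

/-- Randomized-code capacity of the AVC: `max_P min_q I(X;Y_q)`. -/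
def capacity [Fintype 𝒳] [Fintype 𝒴] [Fintype 𝒯] (W : 𝒯 → 𝒳 → 𝒴 → ℝ) : ℝ :=
  ⨆ P : ProbDist 𝒳, ⨅ q : ProbDist 𝒯, mutInfo P.1 (avgCh W q.1)

/-- Capacity-achieving state distributions. -/
def PiTheta [Fintype 𝒳] [Fintype 𝒴] [Fintype 𝒯] (W : 𝒯 → 𝒳 → 𝒴 → ℝ) : Set (ProbDist 𝒯) :=
  {q | (⨆ P : ProbDist 𝒳, mutInfo P.1 (avgCh W q.1)) = capacity W}

/-- Capacity-achieving input distributions. -/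
def PiX [Fintype 𝒳] [Fintype 𝒴] [Fintype 𝒯] (W : 𝒯 → 𝒳 → 𝒴 → ℝ) : Set (ProbDist 𝒳) :=
  {P | (⨅ q : ProbDist 𝒯, mutInfo P.1 (avgCh W q.1)) = capacity W}

/-- Information density (base 2) of a channel `Wc` with input law `P`. -/
def infoDens [Fintype α] (P : α → ℝ) (Wc : α → β → ℝ) (x : α) (y : β) : ℝ :=
  Real.logb 2 (Wc x y / ∑ x', P x' * Wc x' y)

/-- Variance of the information density under the joint law `P × Wc`. -/
def varInfoDens [Fintype α] [Fintype β] (P : α → ℝ) (Wc : α → β → ℝ) : ℝ :=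
  ∑ x, ∑ y, P x * Wc x y * (infoDens P Wc x y - mutInfo P Wc) ^ 2

/-- Channel dispersion (for a given, typically unique, capacity achieving state
distribution `qθ`): the minimum over capacity achieving inputs of the variance of the
information density. -/
def VC [Fintype 𝒳] [Fintype 𝒴] [Fintype 𝒯] (W : 𝒯 → 𝒳 → 𝒴 → ℝ) (qθ : 𝒯 → ℝ) : ℝ :=
  ⨅ P : PiX W, varInfoDens P.1.1 (avgCh W qθ)

/-- Rate-distortion function of a source `P` with distortion measure `dist` at level `D`. -/
def RD [Fintype α] (P : α → ℝ) (dist : α → α → ℝ) (D : ℝ) : ℝ :=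
  ⨅ K : {K : Kernel α α // ∑ a, ∑ b, P a * K.1 a b * dist a b ≤ D}, mutInfo P K.1.1

/-- `λ* = -R'(D)`. -/
def lamStar [Fintype α] (P : α → ℝ) (dist : α → α → ℝ) (D : ℝ) : ℝ :=
  -(deriv (RD P dist) D)

/-- `K` is a minimizer in the rate-distortion problem. -/
def IsRDMinimizer [Fintype α] (P : α → ℝ) (dist : α → α → ℝ) (D : ℝ) (K : α → α → ℝ) : Prop :=
  (∀ a, IsDist (K a)) ∧ (∑ a, ∑ b, P a * K a b * dist a b ≤ D) ∧ mutInfo P K = RD P dist D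

/-- Output marginal of a source `P` through a kernel `K`. -/
def outMarg [Fintype α] (P : α → ℝ) (K : α → α → ℝ) (b : α) : ℝ := ∑ a, P a * K a b

/-- The `D`-tilted information, defined from a rate-distortion minimizer `K`. -/
def dtilted [Fintype α] (P : α → ℝ) (dist : α → α → ℝ) (D : ℝ) (K : α → α → ℝ) (a : α) : ℝ :=
  - Real.logb 2 (∑ b, outMarg P K b *
      (2 : ℝ) ^ (lamStar P dist D * D - lamStar P dist D * dist a b))

/-- Variance of `f` under the distribution `P`. -/
def varOf [Fintype α] (P : α → ℝ) (f : α → ℝ) : ℝ :=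
  ∑ a, P a * (f a - ∑ b, P b * f b) ^ 2

/-- Finiteness of the `D`-tilted information: the expectation inside the logarithm is
strictly positive. -/
def TiltFinite [Fintype α] (P : α → ℝ) (dist : α → α → ℝ) (D : ℝ) (K : α → α → ℝ) : Prop :=
  ∀ a, 0 < ∑ b, outMarg P K b *
      (2 : ℝ) ^ (lamStar P dist D * D - lamStar P dist D * dist a b)

/-- Finiteness of the single-letter information density `i(x;Y)` for every input
distribution: whenever the channel output probability is positive, so is the output
marginal. -/
def InfoDensFinite [Fintype 𝒳] [Fintype 𝒴] [Fintype 𝒯] (W : 𝒯 → 𝒳 → 𝒴 → ℝ)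
    (qθ : 𝒯 → ℝ) : Prop :=
  ∀ (P : ProbDist 𝒳) (x : 𝒳) (y : 𝒴), 0 < avgCh W qθ x y → 0 < ∑ x', P.1 x' * avgCh W qθ x' y

/-- Symmetrizability of the AVC. -/
def Symmetrizable [Fintype 𝒯] (W : 𝒯 → 𝒳 → 𝒴 → ℝ) : Prop :=
  ∃ σ : 𝒳 → 𝒯 → ℝ, (∀ x, IsDist (σ x)) ∧
    ∀ x x' y, ∑ θ, σ x θ * W θ x' y = ∑ θ, σ x' θ * W θ x y

/-- Complementary standard Gaussian CDF. -/
def Qc (t : ℝ) : ℝ := ∫ u in Set.Ioi t, Real.exp (-(u ^ 2) / 2) / Real.sqrt (2 * Real.pi)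

/-- Inverse of the complementary standard Gaussian CDF. -/
def Qcinv (ε : ℝ) : ℝ := Function.invFun Qc ε

/-- `n`-letter channel averaged over a jammer distribution on state sequences. -/
def avgChnQ [Fintype 𝒯] (W : 𝒯 → 𝒳 → 𝒴 → ℝ) (n : ℕ) (q : (Fin n → 𝒯) → ℝ)
    (x : Fin n → 𝒳) (y : Fin n → 𝒴) : ℝ :=
  ∑ θ : Fin n → 𝒯, q θ * nCh W n θ x y

/-- `n`-letter channel averaged over the i.i.d. extension of a single-letter state law. -/
def avgChn [Fintype 𝒯] (W : 𝒯 → 𝒳 → 𝒴 → ℝ) (qθ : 𝒯 → ℝ) (n : ℕ)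
    (x : Fin n → 𝒳) (y : Fin n → 𝒴) : ℝ :=
  ∑ θ : Fin n → 𝒯, prodF qθ n θ * nCh W n θ x y

/-- Probability of the distortion ball `B_D(s)` under a distribution on `𝒮^k`. -/
def ballProb [Fintype 𝒮] (dS : 𝒮 → 𝒮 → ℝ) (D : ℝ) (k : ℕ)
    (PShat : (Fin k → 𝒮) → ℝ) (s : Fin k → 𝒮) : ℝ :=
  ∑ s', ind (dBlock dS k s s' ≤ D) * PShat s'

/-- Error of a deterministic joint source-channel code against state sequence `θ`. -/
def eCode [Fintype 𝒮] [Fintype 𝒴] (W : 𝒯 → 𝒳 → 𝒴 → ℝ) (PS : 𝒮 → ℝ) (dS : 𝒮 → 𝒮 → ℝ)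
    (D : ℝ) (k n : ℕ) (f : (Fin k → 𝒮) → Fin n → 𝒳) (φ : (Fin n → 𝒴) → Fin k → 𝒮)
    (θ : Fin n → 𝒯) : ℝ :=
  ∑ s : Fin k → 𝒮, ∑ y : Fin n → 𝒴,
    ind (dBlock dS k s (φ y) > D) * prodF PS k s * nCh W n θ (f s) y

/-- Deterministic joint source-channel code pairs. -/
abbrev CodePair (𝒮 𝒳 𝒴 : Type*) (k n : ℕ) :=
  ((Fin k → 𝒮) → Fin n → 𝒳) × ((Fin n → 𝒴) → Fin k → 𝒮)

/-- Worst-case (over states) error of a random joint source-channel code `ψ`. -/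
def eRandMax [Fintype 𝒮] [Fintype 𝒳] [Fintype 𝒴] [Fintype 𝒯]
    [DecidableEq 𝒮] [DecidableEq 𝒴]
    (W : 𝒯 → 𝒳 → 𝒴 → ℝ) (PS : 𝒮 → ℝ) (dS : 𝒮 → 𝒮 → ℝ) (D : ℝ) (k n : ℕ)
    (ψ : CodePair 𝒮 𝒳 𝒴 k n → ℝ) : ℝ :=
  ⨆ θ : Fin n → 𝒯, ∑ c : CodePair 𝒮 𝒳 𝒴 k n, ψ c * eCode W PS dS D k n c.1 c.2 θ

/-- Kullback-Leibler divergence (base 2) between pmfs on a finite type. -/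
def klDiv [Fintype α] (P Q : α → ℝ) : ℝ := ∑ a, P a * Real.logb 2 (P a / Q a)

/-- The reference measure `P_X × Q_{X'Θ} × P_{Y|X,Θ}` built from the `(x',θ)`-marginal
of `Q`. -/
def refMeas [Fintype 𝒳] [Fintype 𝒴] [Fintype 𝒯] (W : 𝒯 → 𝒳 → 𝒴 → ℝ) (PX : 𝒳 → ℝ)
    (Q : 𝒳 × 𝒳 × 𝒯 × 𝒴 → ℝ) : 𝒳 × 𝒳 × 𝒯 × 𝒴 → ℝ :=
  fun p => PX p.1 * (∑ x : 𝒳, ∑ y : 𝒴, Q (x, p.2.1, p.2.2.1, y)) * W p.2.2.1 p.1 p.2.2.2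

/-- The set `D_η` of joint distributions within divergence `η` of the reference measure. -/
def Dset [Fintype 𝒳] [Fintype 𝒴] [Fintype 𝒯] (W : 𝒯 → 𝒳 → 𝒴 → ℝ) (PX : 𝒳 → ℝ)
    (η : ℝ) : Set (𝒳 × 𝒳 × 𝒯 × 𝒴 → ℝ) :=
  {Q | IsDist Q ∧ klDiv Q (refMeas W PX Q) ≤ η}

/-- `η*`: the infimum of `η ≥ 0` admitting a coupling whose two marginals lie in `D_η`. -/
def etaStar [Fintype 𝒳] [Fintype 𝒴] [Fintype 𝒯] (W : 𝒯 → 𝒳 → 𝒴 → ℝ) (PX : 𝒳 → ℝ) : ℝ :=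
  sInf {η : ℝ | 0 ≤ η ∧ ∃ Q : 𝒳 × 𝒳 × 𝒯 × 𝒯 × 𝒴 → ℝ, IsDist Q ∧
      (fun p : 𝒳 × 𝒳 × 𝒯 × 𝒴 =>
        ∑ θ' : 𝒯, Q (p.1, p.2.1, p.2.2.1, θ', p.2.2.2)) ∈ Dset W PX η ∧
      (fun p : 𝒳 × 𝒳 × 𝒯 × 𝒴 =>
        ∑ θ : 𝒯, Q (p.2.1, p.1, θ, p.2.2.1, p.2.2.2)) ∈ Dset W PX η}

/-- Joint type (empirical distribution) of four `d`-letter strings. -/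
def jointType4 [Fintype 𝒳] [Fintype 𝒴] [Fintype 𝒯] (d : ℕ)
    (x xb : Fin d → 𝒳) (θ : Fin d → 𝒯) (y : Fin d → 𝒴) : 𝒳 × 𝒳 × 𝒯 × 𝒴 → ℝ :=
  fun a => ((Finset.univ.filter (fun i : Fin d => (x i, xb i, θ i, y i) = a)).card : ℝ) / d

/-- `T` is a type (empirical distribution) of a `d`-letter state sequence. -/
def IsTypeOf [Fintype 𝒯] (d : ℕ) (T : 𝒯 → ℝ) : Prop :=
  ∃ θ : Fin d → 𝒯, ∀ t, T t = ((Finset.univ.filter (fun i : Fin d => θ i = t)).card : ℝ) / d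

end AVCGame

namespace AVCGame

section ExponentialRace

open ProbabilityTheory

/-- The law of independent rate-one exponential clocks indexed by `U`. -/
def clocks (U : Type*) [Fintype U] : Measure (U → ℝ) := Measure.pi fun _ => expMeasure 1

instance (U : Type*) [Fintype U] : IsProbabilityMeasure (clocks U) :=
  have := isProbabilityMeasure_expMeasure one_pos
  inferInstanceAs (IsProbabilityMeasure (Measure.pi fun _ : U => expMeasure 1))

lemma expMeasure_one_Ioi {x : ℝ} (hx : 0 ≤ x) :
    expMeasure 1 (Set.Ioi x) = ENNReal.ofReal (Real.exp (-x)) := by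
  have := isProbabilityMeasure_expMeasure one_pos
  have h := cdf_expMeasure_eq one_pos x
  rw [if_pos hx, one_mul, cdf_eq_real] at h
  rw [← Set.compl_Iic, ← ofReal_measureReal, probReal_compl_eq_one_sub measurableSet_Iic, h]
  congr 1
  ring

lemma ofReal_inv_le_lintegral_expMeasure {C : ℝ} (hC : 0 ≤ C) :
    ENNReal.ofReal (1 / (1 + C)) ≤
      ∫⁻ t, (if 0 ≤ t then ENNReal.ofReal (Real.exp (-(C * t))) else 0) ∂(expMeasure 1) := by
  have hC' : 0 < 1 + C := by linarith
  have hm : Measurable (exponentialPDF 1) :=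
    (measurable_exponentialPDFReal 1).ennreal_ofReal
  have hmC : Measurable (exponentialPDF (1 + C)) :=
    (measurable_exponentialPDFReal (1 + C)).ennreal_ofReal
  change _ ≤ ∫⁻ t, _ ∂(volume.withDensity (exponentialPDF 1))
  rw [lintegral_withDensity_eq_lintegral_mul _ hm
    (Measurable.ite measurableSet_Ici (by fun_prop) measurable_const)]
  calc ENNReal.ofReal (1 / (1 + C))
      = ∫⁻ t, ENNReal.ofReal (1 / (1 + C)) * exponentialPDF (1 + C) t := by
        rw [lintegral_const_mul _ hmC, lintegral_exponentialPDF_eq_one hC', mul_one]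
    _ ≤ _ := by
        refine lintegral_mono fun t => ?_
        simp only [Pi.mul_apply, exponentialPDF_eq]
        split_ifs with ht
        · rw [← ENNReal.ofReal_mul (by positivity), ← ENNReal.ofReal_mul (by positivity), one_mul,
            ← Real.exp_add]
          refine ENNReal.ofReal_le_ofReal (le_of_eq ?_)
          rw [← mul_assoc, one_div_mul_cancel hC'.ne', one_mul]
          congr 1
          ring
        · simp

/-- The clock at `u`, slowed down by `c v` relative to each competitor `v`, rings first with
probability at least `1 / (1 + ∑ c v)`. -/
lemma le_clocks_race {U : Type*} [Fintype U] (u : U) (c : U → ℝ)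
    (hc : ∀ v, 0 ≤ c v) :
    1 / (1 + ∑ v : {v // ¬ v = u}, c v) ≤
      (clocks U).real {ω | 0 ≤ ω u ∧ ∀ v, v ≠ u → c v * ω u < ω v} := by
  have := isProbabilityMeasure_expMeasure one_pos
  have hC : 0 ≤ ∑ v : {v // ¬ v = u}, c v := Finset.sum_nonneg fun v _ => hc v
  set B : Set (({v // v = u} → ℝ) × ({v // ¬ v = u} → ℝ)) :=
    {z | 0 ≤ z.1 ⟨u, rfl⟩ ∧ ∀ v : {v // ¬ v = u}, c v * z.1 ⟨u, rfl⟩ < z.2 v} with hB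
  have hBm : MeasurableSet B := by
    simp only [hB, Set.ofPred_and, Set.ofPred_forall]
    refine (measurableSet_le (by fun_prop) (by fun_prop)).inter ?_
    exact MeasurableSet.iInter fun v => measurableSet_lt (by fun_prop) (by fun_prop)
  have hmp := measurePreserving_piEquivPiSubtypeProd (fun _ : U => expMeasure 1) (· = u)
  have hA : {ω : U → ℝ | 0 ≤ ω u ∧ ∀ v, v ≠ u → c v * ω u < ω v} =
      MeasurableEquiv.piEquivPiSubtypeProd (fun _ : U => ℝ) (· = u) ⁻¹' B := by
    ext ω
    simp [hB, MeasurableEquiv.piEquivPiSubtypeProd]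
  rw [measureReal_def, ← ENNReal.ofReal_le_iff_le_toReal (measure_ne_top _ _), clocks, hA,
    hmp.measure_preimage hBm.nullMeasurableSet, Measure.prod_apply hBm]
  have hev := @measurePreserving_eval {v // v = u} _ (Subtype.fintype (· = u)) _
    (fun _ => expMeasure 1) _ ⟨u, rfl⟩
  refine (ofReal_inv_le_lintegral_expMeasure hC).trans ?_
  rw [← hev.lintegral_comp (Measurable.ite measurableSet_Ici (by fun_prop) measurable_const)]
  refine lintegral_mono fun b => ?_
  simp only [Function.eval]
  split_ifs with hb
  · have hs : Prod.mk b ⁻¹' B =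
        Set.univ.pi fun v : {v // ¬ v = u} => Set.Ioi (c v * b ⟨u, rfl⟩) := by
      ext a
      simp [hB, hb]
    rw [hs, Measure.pi_pi]
    simp only [fun v : {v // ¬ v = u} => expMeasure_one_Ioi (mul_nonneg (hc v) hb)]
    rw [← ENNReal.ofReal_prod_of_nonneg fun _ _ => (Real.exp_pos _).le, ← Real.exp_sum,
      Finset.sum_neg_distrib, Finset.sum_mul]
  · exact zero_le

end ExponentialRace

section Matching

variable {U : Type*}

/-- Clock realizations for which `u` is the unique minimizer of `ω v / p v`. -/
def wins (p : U → ℝ) (u : U) : Set (U → ℝ) := {ω | ∀ v, v ≠ u → p v * ω u < p u * ω v}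

lemma eq_of_mem_wins {p : U → ℝ} {u v : U} {ω : U → ℝ} (hu : ω ∈ wins p u) (hv : ω ∈ wins p v) :
    u = v := by
  by_contra h
  exact lt_asymm (hu v (Ne.symm h)) (hv u h)

variable [Fintype U]

lemma measurableSet_wins (p : U → ℝ) (u : U) : MeasurableSet (wins p u) := by
  simp only [wins, Set.ofPred_forall]
  exact MeasurableSet.iInter fun v => MeasurableSet.iInter fun _ =>
    measurableSet_lt (by fun_prop) (by fun_prop)

/-- Poisson matching lemma: two races run on the same clocks are both won by `u` with probability
at least the harmonic-type mean of the speeds of `u`. -/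
lemma le_clocks_wins_inter {p q : U → ℝ} (hp : IsDist p) (hq : IsDist q) (u : U)
    (hpu : 0 < p u) (hqu : 0 < q u) :
    p u * q u / (p u + q u) ≤ (clocks U).real (wins p u ∩ wins q u) := by
  have hp0 := hp.1
  have hq0 := hq.1
  have hsum : ∀ r : U → ℝ, IsDist r → ∑ v : {v // ¬ v = u}, r v = 1 - r u := fun r hr => by
    have h := Fintype.sum_eq_add_sum_subtype_ne r u
    rw [hr.2] at h
    exact eq_sub_of_add_eq' h.symm
  set c : U → ℝ := fun v => p v / p u + q v / q u with hc
  have hc0 : ∀ v, 0 ≤ c v := fun v =>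
    add_nonneg (div_nonneg (hp0 v) hpu.le) (div_nonneg (hq0 v) hqu.le)
  have hC : ∑ v : {v // ¬ v = u}, c v = (1 - p u) / p u + (1 - q u) / q u := by
    simp only [hc, Finset.sum_add_distrib, ← Finset.sum_div, hsum p hp, hsum q hq]
  calc p u * q u / (p u + q u) ≤ 1 / (1 + ∑ v : {v // ¬ v = u}, c v) := by
        have h0 : 0 ≤ ∑ v : {v // ¬ v = u}, c v := Finset.sum_nonneg fun v _ => hc0 v
        rw [div_le_div_iff₀ (by positivity) (by positivity), hC]
        have h : p u * q u * (1 + ((1 - p u) / p u + (1 - q u) / q u)) =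
            p u + q u - p u * q u := by
          field_simp
          ring
        rw [h]
        nlinarith [mul_pos hpu hqu]
    _ ≤ _ := le_clocks_race u c hc0
    _ ≤ _ := by
        refine measureReal_mono fun ω hω => ?_
        obtain ⟨h0, h⟩ := hω
        refine ⟨fun v hv => ?_, fun v hv => ?_⟩
        · have h1 := h v hv
          have h2 : 0 ≤ q v / q u * ω u := mul_nonneg (div_nonneg (hq0 v) hqu.le) h0
          have h3 : p v / p u * ω u < ω v := by simp only [hc] at h1; linarith
          calc p v * ω u = p u * (p v / p u * ω u) := by field_simp
            _ < p u * ω v := mul_lt_mul_of_pos_left h3 hpu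
        · have h1 := h v hv
          have h2 : 0 ≤ p v / p u * ω u := mul_nonneg (div_nonneg (hp0 v) hpu.le) h0
          have h3 : q v / q u * ω u < ω v := by simp only [hc] at h1; linarith
          calc q v * ω u = q u * (q v / q u * ω u) := by field_simp
            _ < q u * ω v := mul_lt_mul_of_pos_left h3 hqu

variable [Nonempty U]

/-- The winner of the race with speeds `p` (an arbitrary element in case of a tie). -/
def winner (p : U → ℝ) (ω : U → ℝ) : U :=
  if h : ∃ u, ω ∈ wins p u then h.choose else Classical.arbitrary U

lemma winner_eq {p : U → ℝ} {u : U} {ω : U → ℝ} (hu : ω ∈ wins p u) : winner p ω = u := by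
  have h : ∃ u, ω ∈ wins p u := ⟨u, hu⟩
  rw [winner, dif_pos h]
  exact eq_of_mem_wins h.choose_spec hu

lemma measurableSet_winner_eq (p : U → ℝ) (u : U) : MeasurableSet {ω | winner p ω = u} := by
  have h : {ω | winner p ω = u} =
      wins p u ∪ ((⋃ v, wins p v)ᶜ ∩ {_ω | Classical.arbitrary U = u}) := by
    ext ω
    by_cases hω : ∃ v, ω ∈ wins p v
    · obtain ⟨v, hv⟩ := hω
      have : ω ∈ ⋃ v, wins p v := Set.mem_iUnion.2 ⟨v, hv⟩
      simp only [Set.mem_ofPred_eq, winner_eq hv, Set.mem_union, Set.mem_inter_iff,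
        Set.mem_compl_iff, this, not_true_eq_false, false_and, or_false]
      exact ⟨fun h => h ▸ hv, fun h => eq_of_mem_wins hv h⟩
    · have h1 : ω ∉ wins p u := fun h => hω ⟨u, h⟩
      have h2 : ω ∉ ⋃ v, wins p v := fun h => hω (Set.mem_iUnion.1 h)
      simpa [winner, hω, h1] using fun _ v hv => hω ⟨v, hv⟩
  rw [h]
  exact (measurableSet_wins p u).union
    ((MeasurableSet.iUnion fun v => measurableSet_wins p v).compl.inter (MeasurableSet.const _))

/-- A finite family of distributions on `U` admits a joint selection rule under which any two
members select the same `u` with the probability given by the Poisson matching lemma. -/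
lemma exists_pairwise_matching {I : Type*} [Fintype I] [DecidableEq I] (P : I → ProbDist U) :
    ∃ μ : ProbDist (I → U), ∀ i j u,
      (P i).1 u * (P j).1 u / ((P i).1 u + (P j).1 u) ≤
        ∑ a, μ.1 a * ind (a i = u ∧ a j = u) := by
  let _ : MeasurableSpace (I → U) := ⊤
  set X : (U → ℝ) → I → U := fun ω i => winner (P i).1 ω with hX
  have hXm : Measurable X := by
    refine measurable_to_countable' fun a => ?_
    have : X ⁻¹' {a} = ⋂ i, {ω | winner (P i).1 ω = a i} := by
      ext ω
      simp [hX, funext_iff]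
    rw [this]
    exact MeasurableSet.iInter fun i => measurableSet_winner_eq _ _
  have : IsProbabilityMeasure ((clocks U).map X) :=
    Measure.isProbabilityMeasure_map hXm.aemeasurable
  refine ⟨⟨fun a => ((clocks U).map X).real {a}, fun a => measureReal_nonneg, ?_⟩,
    fun i j u => ?_⟩
  · rw [sum_measureReal_singleton, Finset.coe_univ, probReal_univ]
  · have hsum : ∑ a, ((clocks U).map X).real {a} * ind (a i = u ∧ a j = u) =
        (clocks U).real {ω | X ω i = u ∧ X ω j = u} := by
      simp only [ind, mul_ite, mul_one, mul_zero]
      rw [← Finset.sum_filter, sum_measureReal_singleton,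
        map_measureReal_apply hXm (MeasurableSpace.measurableSet_top)]
      congr 1
      ext ω
      simp
    rw [hsum]
    rcases ((P i).2.1 u).eq_or_lt with hi | hi
    · simp [← hi]
    rcases ((P j).2.1 u).eq_or_lt with hj | hj
    · simp [← hj]
    exact (le_clocks_wins_inter (P i).2 (P j).2 u hi hj).trans
      (measureReal_mono fun ω hω => ⟨winner_eq hω.1, winner_eq hω.2⟩)

end Matching

section Distributions

variable {α β : Type*} [Fintype α] [Fintype β]

lemma IsDist.pi {n : ℕ} {p : Fin n → α → ℝ} (hp : ∀ i, IsDist (p i)) :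
    IsDist fun a : Fin n → α => ∏ i, p i (a i) := by
  refine ⟨fun a => Finset.prod_nonneg fun i _ => (hp i).1 _, ?_⟩
  have h := Finset.prod_univ_sum (fun _ : Fin n => (Finset.univ : Finset α)) p
  rw [Fintype.piFinset_univ] at h
  rw [← h]
  exact Finset.prod_eq_one fun i _ => (hp i).2

lemma IsDist.prod {p : α → ℝ} {q : β → ℝ} (hp : IsDist p) (hq : IsDist q) :
    IsDist fun u : α × β => p u.1 * q u.2 := by
  refine ⟨fun u => mul_nonneg (hp.1 _) (hq.1 _), ?_⟩
  rw [Fintype.sum_prod_type, ← Fintype.sum_mul_sum, hp.2, hq.2, one_mul]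

lemma IsDist.normalize {p : α → ℝ} (hp : ∀ a, 0 ≤ p a) {c : ℝ} (hc : 0 < c)
    (hsum : ∑ a, p a = c) : IsDist fun a => p a / c := by
  refine ⟨fun a => div_nonneg (hp a) hc.le, ?_⟩
  rw [← Finset.sum_div, hsum, div_self hc.ne']

lemma ind_nonneg (Q : Prop) : 0 ≤ ind Q := by
  unfold ind
  split_ifs <;> norm_num

lemma ind_le_one (Q : Prop) : ind Q ≤ 1 := by
  unfold ind
  split_ifs <;> norm_num

lemma ind_not (Q : Prop) : ind (¬ Q) = 1 - ind Q := by
  unfold ind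
  by_cases h : Q <;> simp [h]

/-- Push-forward of a distribution along a map. -/
lemma exists_pushforward (μ : ProbDist α) (g : α → β) :
    ∃ ν : ProbDist β, ∀ h : β → ℝ, ∑ b, ν.1 b * h b = ∑ a, μ.1 a * h (g a) := by
  have key : ∀ h : β → ℝ,
      ∑ b, (∑ a, if g a = b then μ.1 a else 0) * h b = ∑ a, μ.1 a * h (g a) := fun h => by
    simp only [Finset.sum_mul, ite_mul, zero_mul]
    rw [Finset.sum_comm]
    simp
  refine ⟨⟨fun b => ∑ a, if g a = b then μ.1 a else 0, fun b => Finset.sum_nonneg fun a _ => ?_,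
    ?_⟩, key⟩
  · split_ifs
    exacts [μ.2.1 a, le_rfl]
  · simpa [μ.2.2] using key fun _ => 1

end Distributions

section OneShot

/-- The success probability guaranteed by matching the posterior of the decoder with the
ball-conditioned proposal of the encoder is at least the complement of the covering and packing
error terms. -/
lemma one_sub_div_le_packing_add_covering {p V out : ℝ} (hp0 : 0 ≤ p) (hp1 : p ≤ 1) (hV : 0 ≤ V)
    (hout : 0 < V → 0 < out) (l : ℕ) :
    1 - p * V / (p * V + out) ≤
      (2 : ℝ) ^ (-(max (Real.logb 2 (V / out) - Real.logb 2 ((l : ℝ) + 1)) 0)) +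
        (1 - p) ^ (l + 1) := by
  have hpow : 0 ≤ (1 - p) ^ (l + 1) := pow_nonneg (by linarith) _
  set L : ℝ := (l : ℝ) + 1 with hL
  have hL1 : 1 ≤ L := by simp [hL]
  rcases hV.eq_or_lt with rfl | hVpos
  · have : 0 ≤ Real.logb 2 L := Real.logb_nonneg one_lt_two hL1
    simp [this, hpow]
  have ho := hout hVpos
  have hden : 0 < p * V + out := by positivity
  rcases le_total (Real.logb 2 (V / out) - Real.logb 2 L) 0 with h | h
  · rw [max_eq_right h]
    have : 0 ≤ p * V / (p * V + out) := by positivity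
    simp only [neg_zero, Real.rpow_zero]
    linarith
  · have hexp : (2 : ℝ) ^ (-(Real.logb 2 (V / out) - Real.logb 2 L)) = L * out / V := by
      rw [neg_sub, ← Real.logb_div (by positivity) (by positivity),
        Real.rpow_logb (by norm_num) (by norm_num) (by positivity)]
      field_simp
    rw [max_eq_left h, hexp]
    have h1 : 1 - p * V / (p * V + out) = out / (p * V + out) := by
      field_simp
      ring
    rw [h1]
    rcases le_total 1 (L * p) with hLp | hLp
    · refine le_add_of_le_of_nonneg ?_ hpow
      rw [div_le_div_iff₀ hden hVpos]
      nlinarith [mul_nonneg (sub_nonneg.2 hLp) (mul_pos ho hVpos).le, mul_pos ho ho]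
    · have hb : 1 - L * p ≤ (1 - p) ^ (l + 1) := by
        have := one_add_mul_le_pow (a := -p) (by linarith) (l + 1)
        push_cast at this
        rw [hL]
        convert! this using 1; ring
      refine le_trans ?_ (add_le_add_right hb _)
      rw [div_add' _ _ _ hVpos.ne', div_le_div_iff₀ hden hVpos]
      nlinarith [mul_nonneg (mul_nonneg (sub_nonneg.2 hLp) hp0) (mul_pos hVpos hVpos).le,
        mul_pos ho ho]

variable {S X Y : Type*} [Fintype S] [Fintype X] [Fintype Y]

lemma harmonic_identity {p V out m : ℝ} (hp : 0 < p) (hV : 0 ≤ V) (hout : 0 < out) :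
    m / p * (m * V / out) / (m / p + m * V / out) = m * (V / (p * V + out)) := by
  rcases eq_or_ne m 0 with rfl | hm
  · simp
  have h1 : p * V + out ≠ 0 := by positivity
  have h2 : m / p + m * V / out = m * (p * V + out) / (p * out) := by
    field_simp
    ring
  rw [h2]
  field_simp

/-- One-shot random joint source-channel code obtained from pairwise matching: the encoder proposes
a codeword together with a reproduction in the ball `B s`, and the decoder, designed for the
channel `V`, proposes a pair according to its posterior. The guarantee holds simultaneously
for all nonnegative channels `w`. -/
lemma exists_matched_code [DecidableEq S] [DecidableEq Y] (PX : ProbDist X) (PR : ProbDist S) (V : X → Y → ℝ)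
    (hV : ∀ x y, 0 ≤ V x y) (B : S → S → Prop) :
    ∃ μ : ProbDist (S ⊕ Y → X × S), ∀ (w : X → Y → ℝ), (∀ x y, 0 ≤ w x y) → ∀ s,
      ∑ x, ∑ y, PX.1 x * w x y * ((∑ s', ind (B s s') * PR.1 s') * V x y /
          ((∑ s', ind (B s s') * PR.1 s') * V x y + ∑ x', PX.1 x' * V x' y)) ≤
        ∑ a, μ.1 a * ∑ y, w (a (.inl s)).1 y * ind (B s (a (.inr y)).2) := by
  have : Nonempty X := not_isEmpty_iff.1 fun _ => by simpa using PX.2.2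
  have : Nonempty S := not_isEmpty_iff.1 fun _ => by simpa using PR.2.2
  set p : S → ℝ := fun s => ∑ s', ind (B s s') * PR.1 s' with hp
  set out : Y → ℝ := fun y => ∑ x', PX.1 x' * V x' y with hout
  have hPX := PX.2.1
  have hPR := PR.2.1
  have hp0 : ∀ s, 0 ≤ p s := fun s =>
    Finset.sum_nonneg fun s' _ => mul_nonneg (ind_nonneg _) (hPR s')
  have hout0 : ∀ y, 0 ≤ out y := fun y =>
    Finset.sum_nonneg fun x _ => mul_nonneg (hPX x) (hV x y)
  let enc : S → ProbDist (X × S) := fun s =>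
    if h : 0 < p s then
      ⟨fun u => PX.1 u.1 * (ind (B s u.2) * PR.1 u.2 / p s), PX.2.prod
        (IsDist.normalize (fun s' => mul_nonneg (ind_nonneg _) (hPR s')) h rfl)⟩
    else ⟨fun u => PX.1 u.1 * PR.1 u.2, PX.2.prod PR.2⟩
  let dec : Y → ProbDist (X × S) := fun y =>
    if h : 0 < out y then
      ⟨fun u => PX.1 u.1 * V u.1 y / out y * PR.1 u.2,
        (IsDist.normalize (fun x => mul_nonneg (hPX x) (hV x y)) h rfl).prod PR.2⟩
    else ⟨fun u => PX.1 u.1 * PR.1 u.2, PX.2.prod PR.2⟩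
  obtain ⟨μ, hμ⟩ := exists_pairwise_matching (Sum.elim enc dec)
  refine ⟨μ, fun w hw s => ?_⟩
  change ∑ x, ∑ y, PX.1 x * w x y * (p s * V x y / (p s * V x y + out y)) ≤ _
  rcases (hp0 s).eq_or_lt with hs | hs
  · simp only [← hs, zero_mul, zero_div, mul_zero, Finset.sum_const_zero]
    exact Finset.sum_nonneg fun a _ => mul_nonneg (μ.2.1 a)
      (Finset.sum_nonneg fun y _ => mul_nonneg (hw _ _) (ind_nonneg _))
  have hcollapse : ∀ (a : S ⊕ Y → X × S) (y : Y),
      ∑ u : X × S, w u.1 y * ind (B s u.2) * ind (a (.inl s) = u ∧ a (.inr y) = u) ≤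
        w (a (.inl s)).1 y * ind (B s (a (.inr y)).2) := fun a y => by
    rw [Finset.sum_eq_single (a (.inl s))]
    · by_cases h : a (.inr y) = a (.inl s)
      · simp [ind, h]
      · simpa [ind, h] using mul_nonneg (hw _ y) (ind_nonneg (B s (a (.inr y)).2))
    · intro u _ hu
      simp [ind, Ne.symm hu]
    · simp
  have hmatch : ∀ y, ∑ x, PX.1 x * w x y * (p s * V x y / (p s * V x y + out y)) ≤
      ∑ u : X × S, w u.1 y * ind (B s u.2) *
        ∑ a, μ.1 a * ind (a (.inl s) = u ∧ a (.inr y) = u) := fun y => by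
    rcases (hout0 y).eq_or_lt with hy | hy
    · have hz : ∀ x, PX.1 x * V x y = 0 := fun x =>
        (Finset.sum_eq_zero_iff_of_nonneg fun x _ => mul_nonneg (hPX x) (hV x y)).1 hy.symm x
          (Finset.mem_univ x)
      rw [Finset.sum_eq_zero fun x _ => ?_]
      · exact Finset.sum_nonneg fun u _ => mul_nonneg (mul_nonneg (hw _ _) (ind_nonneg _))
          (Finset.sum_nonneg fun a _ => mul_nonneg (μ.2.1 a) (ind_nonneg _))
      · rcases mul_eq_zero.1 (hz x) with h | h <;> simp [h]
    rw [Fintype.sum_prod_type]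
    refine Finset.sum_le_sum fun x _ => ?_
    calc PX.1 x * w x y * (p s * V x y / (p s * V x y + out y))
        = ∑ s', w x y * ind (B s s') *
            (PX.1 x * PR.1 s' * (V x y / (p s * V x y + out y))) := by
          rw [mul_div_assoc, hp, Finset.sum_mul, Finset.mul_sum]
          exact Finset.sum_congr rfl fun s' _ => by ring
      _ ≤ _ := Finset.sum_le_sum fun s' _ => ?_
    by_cases hB : B s s'
    · refine mul_le_mul_of_nonneg_left ?_ (mul_nonneg (hw _ _) (ind_nonneg _))
      have h := hμ (.inl s) (.inr y) (x, s')
      have he : (enc s).1 (x, s') = PX.1 x * PR.1 s' / p s := by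
        simp only [enc, dif_pos hs, ind, if_pos hB]
        ring
      have hd : (dec y).1 (x, s') = PX.1 x * PR.1 s' * V x y / out y := by
        simp only [dec, dif_pos hy]
        ring
      simp only [Sum.elim_inl, Sum.elim_inr, he, hd] at h
      rwa [harmonic_identity hs (hV x y) hy] at h
    · simp [ind, hB]
  calc ∑ x, ∑ y, PX.1 x * w x y * (p s * V x y / (p s * V x y + out y))
      ≤ ∑ y, ∑ u : X × S, w u.1 y * ind (B s u.2) *
          ∑ a, μ.1 a * ind (a (.inl s) = u ∧ a (.inr y) = u) := by
        rw [Finset.sum_comm]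
        exact Finset.sum_le_sum fun y _ => hmatch y
    _ = ∑ a, μ.1 a * ∑ y, ∑ u : X × S,
          w u.1 y * ind (B s u.2) * ind (a (.inl s) = u ∧ a (.inr y) = u) := by
        simp only [Finset.mul_sum]
        rw [Finset.sum_congr rfl fun y _ => Finset.sum_comm, Finset.sum_comm]
        exact Finset.sum_congr rfl fun a _ => Finset.sum_congr rfl fun y _ =>
          Finset.sum_congr rfl fun u _ => by ring
    _ ≤ _ := Finset.sum_le_sum fun a _ => mul_le_mul_of_nonneg_left
        (Finset.sum_le_sum fun y _ => hcollapse a y) (μ.2.1 a)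

end OneShot

section JointCoding

variable {𝒮 𝒳 𝒴 𝒯 : Type*} [Fintype 𝒮] [Fintype 𝒴]

lemma isDist_nCh {W : 𝒯 → 𝒳 → 𝒴 → ℝ} (hW : ∀ θ x, IsDist (W θ x)) (n : ℕ)
    (θ : Fin n → 𝒯) (x : Fin n → 𝒳) : IsDist (nCh W n θ x) :=
  IsDist.pi fun i => hW (θ i) (x i)

lemma eCode_eq {W : 𝒯 → 𝒳 → 𝒴 → ℝ} (hW : ∀ θ x, IsDist (W θ x)) (PS : 𝒮 → ℝ)
    (dS : 𝒮 → 𝒮 → ℝ) (D : ℝ) (k n : ℕ) (f : (Fin k → 𝒮) → Fin n → 𝒳)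
    (φ : (Fin n → 𝒴) → Fin k → 𝒮) (θ : Fin n → 𝒯) :
    eCode W PS dS D k n f φ θ =
      ∑ s, prodF PS k s * (1 - ∑ y, nCh W n θ (f s) y * ind (dBlock dS k s (φ y) ≤ D)) := by
  refine Finset.sum_congr rfl fun s _ => ?_
  rw [← (isDist_nCh hW n θ (f s)).2, ← Finset.sum_sub_distrib, Finset.mul_sum]
  refine Finset.sum_congr rfl fun y _ => ?_
  rw [gt_iff_lt, ← not_le, ind_not]
  ring

variable [Fintype 𝒳]

/-- There is a random code whose error, for every state sequence, is bounded by the expected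
failure probability of pairwise matching. -/
lemma exists_random_code {W : 𝒯 → 𝒳 → 𝒴 → ℝ} (hW : ∀ θ x, IsDist (W θ x)) {PS : 𝒮 → ℝ}
    (hPS : IsDist PS) (dS : 𝒮 → 𝒮 → ℝ) (D : ℝ) (k n : ℕ) [Fintype (CodePair 𝒮 𝒳 𝒴 k n)]
    (PX : ProbDist (Fin n → 𝒳)) (PShat : ProbDist (Fin k → 𝒮))
    (V : (Fin n → 𝒳) → (Fin n → 𝒴) → ℝ) (hV : ∀ x y, 0 ≤ V x y) :
    ∃ ψ : ProbDist (CodePair 𝒮 𝒳 𝒴 k n), ∀ θ : Fin n → 𝒯,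
      ∑ c, ψ.1 c * eCode W PS dS D k n c.1 c.2 θ ≤
        ∑ s, prodF PS k s * ∑ x, ∑ y, PX.1 x * nCh W n θ x y *
          (1 - ballProb dS D k PShat.1 s * V x y /
            (ballProb dS D k PShat.1 s * V x y + ∑ x', PX.1 x' * V x' y)) := by
  obtain ⟨μ, hμ⟩ := exists_matched_code PX PShat V hV fun s s' => dBlock dS k s s' ≤ D
  obtain ⟨ψ, hψ⟩ := exists_pushforward (β := CodePair 𝒮 𝒳 𝒴 k n) μ
    fun a => (fun s => (a (.inl s)).1, fun y => (a (.inr y)).2)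
  refine ⟨ψ, fun θ => ?_⟩
  have hN := isDist_nCh hW n θ
  rw [hψ fun c => eCode W PS dS D k n c.1 c.2 θ]
  simp only [eCode_eq hW, Finset.mul_sum (s := (Finset.univ : Finset (Fin k → 𝒮)))]
  rw [Finset.sum_comm]
  refine Finset.sum_le_sum fun s _ => ?_
  have hs : 0 ≤ prodF PS k s := (IsDist.pi fun _ : Fin k => hPS).1 s
  calc _ = prodF PS k s * (1 - ∑ a, μ.1 a * ∑ y, nCh W n θ (a (.inl s)).1 y *
          ind (dBlock dS k s (a (.inr y)).2 ≤ D)) := by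
        rw [mul_sub, ← μ.2.2, Finset.mul_sum, Finset.mul_sum, ← Finset.sum_sub_distrib]
        refine Finset.sum_congr rfl fun a _ => ?_
        rw [μ.2.2]
        ring
    _ ≤ prodF PS k s * _ :=
        mul_le_mul_of_nonneg_left (sub_le_sub_left (hμ (nCh W n θ) (fun x => (hN x).1) s) 1) hs
    _ = _ := by
        have h1 : ∑ x, ∑ y, PX.1 x * nCh W n θ x y = 1 := by
          simp only [← Finset.mul_sum, (hN _).2, mul_one, PX.2.2]
        congr 1
        simp only [mul_sub, mul_one, Finset.sum_sub_distrib, h1]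
        rfl

lemma ballProb_nonneg (dS : 𝒮 → 𝒮 → ℝ) (D : ℝ) (k : ℕ) (P : ProbDist (Fin k → 𝒮))
    (s : Fin k → 𝒮) : 0 ≤ ballProb dS D k P.1 s :=
  Finset.sum_nonneg fun s' _ => mul_nonneg (ind_nonneg _) (P.2.1 s')

lemma ballProb_le_one (dS : 𝒮 → 𝒮 → ℝ) (D : ℝ) (k : ℕ) (P : ProbDist (Fin k → 𝒮))
    (s : Fin k → 𝒮) : ballProb dS D k P.1 s ≤ 1 := by
  rw [← P.2.2]
  exact Finset.sum_le_sum fun s' _ => mul_le_of_le_one_left (P.2.1 s') (ind_le_one _)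

/-- The matching failure probability is bounded by the packing and covering errors for any
random list size `L = l + 1 ≤ M` chosen given the source. -/
lemma matching_failure_le {W : 𝒯 → 𝒳 → 𝒴 → ℝ} (hW : ∀ θ x, IsDist (W θ x)) {PS : 𝒮 → ℝ}
    (hPS : IsDist PS) (dS : 𝒮 → 𝒮 → ℝ) (D : ℝ) (k n M : ℕ)
    (PX : ProbDist (Fin n → 𝒳)) (PShat : ProbDist (Fin k → 𝒮))
    (V : (Fin n → 𝒳) → (Fin n → 𝒴) → ℝ) (hV : ∀ x y, 0 ≤ V x y)
    (PL : Kernel (Fin k → 𝒮) (Fin M)) (θ : Fin n → 𝒯) :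
    ∑ s, prodF PS k s * ∑ x, ∑ y, PX.1 x * nCh W n θ x y *
        (1 - ballProb dS D k PShat.1 s * V x y /
          (ballProb dS D k PShat.1 s * V x y + ∑ x', PX.1 x' * V x' y)) ≤
      (∑ s, ∑ l, ∑ x, ∑ y, prodF PS k s * PL.1 s l * PX.1 x * nCh W n θ x y *
          (2 : ℝ) ^ (-(max (infoDens PX.1 V x y - Real.logb 2 ((l : ℕ) + 1)) 0)))
        + ∑ s, ∑ l, prodF PS k s * PL.1 s l *
            (1 - ballProb dS D k PShat.1 s) ^ ((l : ℕ) + 1) := by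
  have hN := isDist_nCh hW n θ
  have h1 : ∑ x, ∑ y, PX.1 x * nCh W n θ x y = 1 := by
    simp only [← Finset.mul_sum, (hN _).2, mul_one, PX.2.2]
  rw [← Finset.sum_add_distrib]
  refine Finset.sum_le_sum fun s _ => ?_
  rw [← Finset.sum_add_distrib]
  have hs : 0 ≤ prodF PS k s := (IsDist.pi fun _ : Fin k => hPS).1 s
  set F : ℝ := ∑ x, ∑ y, PX.1 x * nCh W n θ x y *
        (1 - ballProb dS D k PShat.1 s * V x y /
          (ballProb dS D k PShat.1 s * V x y + ∑ x', PX.1 x' * V x' y)) with hF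
  have hPL : prodF PS k s * F = ∑ l, prodF PS k s * PL.1 s l * F := by
    rw [← Finset.sum_mul, ← Finset.mul_sum, (PL.2 s).2, mul_one]
  rw [hPL]
  refine Finset.sum_le_sum fun l _ => ?_
  have hl : F ≤ ∑ x, ∑ y, PX.1 x * nCh W n θ x y *
      ((2 : ℝ) ^ (-(max (infoDens PX.1 V x y - Real.logb 2 ((l : ℕ) + 1)) 0)) +
        (1 - ballProb dS D k PShat.1 s) ^ ((l : ℕ) + 1)) := by
    refine Finset.sum_le_sum fun x _ => Finset.sum_le_sum fun y _ => ?_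
    rcases (PX.2.1 x).eq_or_lt with hx | hx
    · simp [← hx]
    refine mul_le_mul_of_nonneg_left ?_ (mul_nonneg hx.le ((hN x).1 y))
    refine one_sub_div_le_packing_add_covering (ballProb_nonneg ..) (ballProb_le_one ..) (hV x y)
      (fun h => ?_) l
    exact (mul_pos hx h).trans_le (Finset.single_le_sum (f := fun x' => PX.1 x' * V x' y)
      (fun x' _ => mul_nonneg (PX.2.1 x') (hV x' y)) (Finset.mem_univ x))
  refine (mul_le_mul_of_nonneg_left hl (mul_nonneg hs ((PL.2 s).1 l))).trans (le_of_eq ?_)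
  simp only [mul_add, Finset.sum_add_distrib, ← Finset.sum_mul, h1, one_mul, Finset.mul_sum]
  simp only [mul_assoc]

end JointCoding

end AVCGame

open AVCGame Filter

/-- Random joint source-channel code achievability (Theorem 6 of the
paper): there is a random joint source-channel code whose worst-case error is bounded by
the stated expression involving the information density and the distortion-ball
probability. -/
theorem random_jscc_achievability
    {𝒮 𝒳 𝒴 𝒯 : Type*} [Fintype 𝒮] [Fintype 𝒳] [Fintype 𝒴] [Fintype 𝒯]
    [DecidableEq 𝒮] [DecidableEq 𝒴]
    [Nonempty 𝒮] [Nonempty 𝒳] [Nonempty 𝒴] [Nonempty 𝒯]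
    (W : 𝒯 → 𝒳 → 𝒴 → ℝ) (hW : ∀ θ x, IsDist (W θ x))
    (PS : 𝒮 → ℝ) (hPS : IsDist PS)
    (dS : 𝒮 → 𝒮 → ℝ) (hdS : ∀ s s', 0 ≤ dS s s') (D : ℝ) (hD : 0 ≤ D)
    (k n M : ℕ) (hM : 0 < M)
    (PX : ProbDist (Fin n → 𝒳)) (PShat : ProbDist (Fin k → 𝒮))
    (qstar : ProbDist 𝒯) (hqstar : qstar ∈ PiTheta W) :
    ∃ ψ : ProbDist (CodePair 𝒮 𝒳 𝒴 k n),
      eRandMax W PS dS D k n ψ.1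
      ≤ ⨅ PL : Kernel (Fin k → 𝒮) (Fin M), ⨆ θ : Fin n → 𝒯,
          ((∑ s : Fin k → 𝒮, ∑ l : Fin M, ∑ x : Fin n → 𝒳, ∑ y : Fin n → 𝒴,
              prodF PS k s * PL.1 s l * PX.1 x * nCh W n θ x y *
                (2 : ℝ) ^ (-(max (infoDens PX.1 (avgChn W qstar.1 n) x y -
                    Real.logb 2 ((l : ℕ) + 1)) 0)))
           + ∑ s : Fin k → 𝒮, ∑ l : Fin M,
               prodF PS k s * PL.1 s l *
                 (1 - ballProb dS D k PShat.1 s) ^ ((l : ℕ) + 1)) := by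
  have hq : IsDist (prodF qstar.1 n) := IsDist.pi fun _ => qstar.2
  have hV : ∀ x y, 0 ≤ avgChn W qstar.1 n x y := fun x y =>
    Finset.sum_nonneg fun θ _ => mul_nonneg (hq.1 θ) ((isDist_nCh hW n θ x).1 y)
  obtain ⟨ψ, hψ⟩ := exists_random_code hW hPS dS D k n PX PShat (avgChn W qstar.1 n) hV
  have : Nonempty (Fin M) := ⟨⟨0, hM⟩⟩
  have : Nonempty (Kernel (Fin k → 𝒮) (Fin M)) :=
    ⟨⟨fun _ => Pi.single ⟨0, hM⟩ 1, fun _ => ⟨fun l => by simp only [Pi.single_apply]; split_ifs <;> norm_num, by simp⟩⟩⟩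
  refine ⟨ψ, le_ciInf fun PL => ciSup_le fun θ => ?_⟩
  exact ((hψ θ).trans (matching_failure_le hW hPS dS D k n M PX PShat _ hV PL θ)).trans
    (le_ciSup (Set.finite_range fun θ : Fin n → 𝒯 =>
      (∑ s : Fin k → 𝒮, ∑ l : Fin M, ∑ x : Fin n → 𝒳, ∑ y : Fin n → 𝒴,
        prodF PS k s * PL.1 s l * PX.1 x * nCh W n θ x y *
          (2 : ℝ) ^ (-(max (infoDens PX.1 (avgChn W qstar.1 n) x y -
            Real.logb 2 ((l : ℕ) + 1)) 0)))
      + ∑ s : Fin k → 𝒮, ∑ l : Fin M,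
          prodF PS k s * PL.1 s l *
            (1 - ballProb dS D k PShat.1 s) ^ ((l : ℕ) + 1)).bddAbove θ)
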